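/- Tame estimate for the action of an operator with finite block-decay norm (Lemma 2.8): Let ν ≥ 1 and s ≥ s₀. There exists a constant C = C(s, ν) > 0 such that for every Töplitz-in-time 2×2 block operator R with |R|_s < ∞ and every h : ℤ^ν × ℕ₊ → ℂ² with ‖h‖_s < ∞, the sequence (R · h)(ℓ, j) := ∑_{ℓ' ∈ ℤ^ν, j' ∈ ℕ₊} R(ℓ − ℓ', j, j') · h(ℓ', j') (matrix–vector product) satisfies ‖R · h‖_s ≤ C (|R|_s ‖h‖_{s₀} + |R|_{s₀} ‖h‖_s). -/

import Mathlib

open scoped ENNReal NNReal BigOperators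

/-- A Töplitz-in-time `2 × 2` block operator: `R ℓ j j'` is the block coupling the
space modes `±j'` to `±j` at time-Fourier index `ℓ`. -/
abbrev BlockOp (ν : ℕ) := (Fin ν → ℤ) → ℕ+ → ℕ+ → Matrix (Fin 2) (Fin 2) ℂ

/-- The weight `⟨(ℓ, m)⟩^{2s} = max(1, ‖ℓ‖_∞, |m|)^{2s}` as an extended real. -/
noncomputable def bwt (ν : ℕ) (s : ℝ) (ℓ : Fin ν → ℤ) (m : ℤ) : ℝ≥0∞ :=
  ENNReal.ofReal ((max 1 (max ‖ℓ‖ ((|m| : ℤ) : ℝ))) ^ (2 * s))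

/-- The squared Frobenius norm of a `2 × 2` complex matrix, as an extended real. -/
noncomputable def frobSq (M : Matrix (Fin 2) (Fin 2) ℂ) : ℝ≥0∞ :=
  ∑ i : Fin 2, ∑ j : Fin 2, (‖M i j‖₊ : ℝ≥0∞) ^ 2

/-- The block-decay norm
`|R|_s = sup_{j'} (∑_{ℓ, j} ⟨(ℓ, j − j')⟩^{2s} ‖R(ℓ,j,j')‖²)^{1/2}` (valued in `ℝ≥0∞`). -/
noncomputable def blockNorm {ν : ℕ} (s : ℝ) (R : BlockOp ν) : ℝ≥0∞ :=
  ⨆ j' : ℕ+, (∑' ℓ : Fin ν → ℤ, ∑' j : ℕ+,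
    bwt ν s ℓ (((j : ℕ) : ℤ) - ((j' : ℕ) : ℤ)) * frobSq (R ℓ j j')) ^ (1/2 : ℝ)

/-- The squared Euclidean norm of a vector in `ℂ²`, as an extended real. -/
noncomputable def vecSq (v : Fin 2 → ℂ) : ℝ≥0∞ :=
  ∑ i : Fin 2, (‖v i‖₊ : ℝ≥0∞) ^ 2

/-- The weighted `ℓ²` norm `‖h‖_s = (∑_{ℓ, j} ⟨(ℓ, j)⟩^{2s} ‖h(ℓ, j)‖²)^{1/2}`
on sequences `h : ℤ^ν × ℕ₊ → ℂ²` (valued in `ℝ≥0∞`). -/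
noncomputable def seqNorm {ν : ℕ} (s : ℝ) (h : (Fin ν → ℤ) → ℕ+ → Fin 2 → ℂ) : ℝ≥0∞ :=
  (∑' ℓ : Fin ν → ℤ, ∑' j : ℕ+, bwt ν s ℓ ((j : ℕ) : ℤ) * vecSq (h ℓ j)) ^ (1/2 : ℝ)

/-- The action of a block operator on a sequence:
`(R·h)(ℓ, j) = ∑_{ℓ', j'} R(ℓ − ℓ', j, j') · h(ℓ', j')`. -/
noncomputable def bact {ν : ℕ} (R : BlockOp ν) (h : (Fin ν → ℤ) → ℕ+ → Fin 2 → ℂ) :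
    (Fin ν → ℤ) → ℕ+ → Fin 2 → ℂ :=
  fun ℓ j => ∑' q : (Fin ν → ℤ) × ℕ+, (R (ℓ - q.1) j q.2).mulVec (h q.1 q.2)

/-- `s₀ = ⌊(ν+1)/2⌋ + 1`. -/
def s0 (ν : ℕ) : ℕ := (ν + 1) / 2 + 1

namespace ENNReal

lemma rpow_half_sq (x : ℝ≥0∞) : (x ^ (1 / 2 : ℝ)) ^ 2 = x := by
  rw [← rpow_ofNat, ← rpow_mul]; norm_num

lemma le_rpow_half_of_sq_le {x y : ℝ≥0∞} (h : x ^ 2 ≤ y) : x ≤ y ^ (1 / 2 : ℝ) := by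
  rwa [← ENNReal.pow_le_pow_left_iff two_ne_zero, rpow_half_sq]

lemma add_sq_le_two_mul (x y : ℝ≥0∞) : (x + y) ^ 2 ≤ 2 * (x ^ 2 + y ^ 2) := by
  have h := rpow_add_le_mul_rpow_add_rpow x y one_le_two
  norm_num at h
  exact h

/-- Cauchy–Schwarz inequality for infinite sums. -/
lemma sq_tsum_le_of_sq_le_mul {ι : Type*} {f c d : ι → ℝ≥0∞} (h : ∀ i, f i ^ 2 ≤ c i * d i) :
    (∑' i, f i) ^ 2 ≤ (∑' i, c i) * ∑' i, d i := by
  have hle (i : ι) : f i ≤ c i ^ (1 / 2 : ℝ) * d i ^ (1 / 2 : ℝ) := by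
    rw [← mul_rpow_of_nonneg _ _ (by norm_num)]
    exact le_rpow_half_of_sq_le (h i)
  have hsum : ∑' i, f i ≤ (∑' i, c i) ^ (1 / 2 : ℝ) * (∑' i, d i) ^ (1 / 2 : ℝ) := by
    rw [ENNReal.tsum_eq_iSup_sum (f := f)]
    refine iSup_le fun F ↦ ?_
    calc ∑ i ∈ F, f i ≤ ∑ i ∈ F, c i ^ (1 / 2 : ℝ) * d i ^ (1 / 2 : ℝ) :=
          Finset.sum_le_sum fun i _ ↦ hle i
      _ ≤ (∑ i ∈ F, (c i ^ (1 / 2 : ℝ)) ^ (2 : ℝ)) ^ (1 / 2 : ℝ) *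
            (∑ i ∈ F, (d i ^ (1 / 2 : ℝ)) ^ (2 : ℝ)) ^ (1 / 2 : ℝ) :=
          ENNReal.inner_le_Lp_mul_Lq F _ _ Real.HolderConjugate.two_two
      _ ≤ _ := by
          simp only [rpow_ofNat, rpow_half_sq]
          gcongr <;> exact ENNReal.sum_le_tsum F
  calc (∑' i, f i) ^ 2
      ≤ ((∑' i, c i) ^ (1 / 2 : ℝ) * (∑' i, d i) ^ (1 / 2 : ℝ)) ^ 2 := by gcongr
    _ = _ := by
      rw [← mul_rpow_of_nonneg _ _ (by norm_num), rpow_half_sq]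

/-- Weighted Schur test with a column bound on the kernel. -/
lemma tsum_sq_tsum_le {ι : Type*} {f c x : ι → ι → ℝ≥0∞} {y : ι → ℝ≥0∞} {K X : ℝ≥0∞}
    (h : ∀ p q, f p q ^ 2 ≤ c p q * (x p q * y q)) (hc : ∀ p, ∑' q, c p q ≤ K)
    (hx : ∀ q, ∑' p, x p q ≤ X) :
    ∑' p, (∑' q, f p q) ^ 2 ≤ K * (X * ∑' q, y q) := by
  calc ∑' p, (∑' q, f p q) ^ 2 ≤ ∑' p, K * ∑' q, x p q * y q := by
        refine ENNReal.tsum_le_tsum fun p ↦ (sq_tsum_le_of_sq_le_mul (h p)).trans ?_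
        gcongr
        exact hc p
    _ = K * ∑' q, (∑' p, x p q) * y q := by
        rw [ENNReal.tsum_mul_left, ENNReal.tsum_comm]
        simp only [ENNReal.tsum_mul_right]
    _ ≤ K * (X * ∑' q, y q) := by
        rw [← ENNReal.tsum_mul_left (a := X)]
        exact mul_le_mul' le_rfl (ENNReal.tsum_le_tsum fun q ↦ mul_le_mul' (hx q) le_rfl)

lemma tsum_prod_pi_ne_top {a : ℤ → ℝ≥0∞} (ha : ∑' n, a n ≠ ⊤) (n : ℕ) :
    ∑' x : Fin n → ℤ, ∏ i, a (x i) ≠ ⊤ := by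
  induction n with
  | zero => simp
  | succ n ih =>
    rw [← (Fin.consEquiv fun _ : Fin (n + 1) ↦ ℤ).tsum_eq, ENNReal.tsum_prod']
    simp only [Fin.consEquiv, Equiv.coe_fn_mk, Fin.prod_univ_succ, Fin.cons_zero, Fin.cons_succ,
      ENNReal.tsum_mul_left, ENNReal.tsum_mul_right]
    exact ENNReal.mul_ne_top ha ih

end ENNReal

lemma tsum_ofReal_max_one_abs_rpow_ne_top {t : ℝ} (ht : 1 < t) :
    ∑' n : ℤ, ENNReal.ofReal ((max 1 ((|n| : ℤ) : ℝ)) ^ (-t)) ≠ ⊤ := by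
  have hs : Summable fun n : ℤ ↦ |(n : ℝ)| ^ (-t) + if n = 0 then 1 else 0 :=
    (Real.summable_abs_int_rpow ht).add (summable_of_ne_finset_zero (s := {0}) (by simp))
  refine ne_top_of_le_ne_top hs.tsum_ofReal_ne_top (ENNReal.tsum_le_tsum fun n ↦ ?_)
  refine ENNReal.ofReal_le_ofReal ?_
  by_cases hn : n = 0
  · subst hn
    simp [Real.zero_rpow (by linarith : -t ≠ 0)]
  · have h1 : (1 : ℝ) ≤ ((|n| : ℤ) : ℝ) := by exact_mod_cast Int.one_le_abs hn
    rw [max_eq_right h1]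
    simp [hn]

section Weight

variable {ν : ℕ}

lemma bwt_base_pos (ℓ : Fin ν → ℤ) (m : ℤ) : 0 < max 1 (max ‖ℓ‖ ((|m| : ℤ) : ℝ)) :=
  lt_max_of_lt_left one_pos

lemma bwt_ne_top (s : ℝ) (ℓ : Fin ν → ℤ) (m : ℤ) : bwt ν s ℓ m ≠ ⊤ := ENNReal.ofReal_ne_top

lemma bwt_ne_zero (s : ℝ) (ℓ : Fin ν → ℤ) (m : ℤ) : bwt ν s ℓ m ≠ 0 := by
  rw [bwt, ne_eq, ENNReal.ofReal_eq_zero, not_le]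
  exact Real.rpow_pos_of_pos (bwt_base_pos ℓ m) _

lemma bwt_half_sq (s : ℝ) (ℓ : Fin ν → ℤ) (m : ℤ) : bwt ν (s / 2) ℓ m ^ 2 = bwt ν s ℓ m := by
  have hpos := bwt_base_pos ℓ m
  rw [bwt, bwt, ← ENNReal.ofReal_pow (Real.rpow_nonneg hpos.le _), ← Real.rpow_natCast,
    ← Real.rpow_mul hpos.le]
  congr 2
  push_cast
  ring

/-- Quasi-subadditivity of the weight. -/
lemma bwt_add_le {s : ℝ} (hs : 0 ≤ s) (ℓ ℓ' : Fin ν → ℤ) (m m' : ℤ) :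
    bwt ν s (ℓ + ℓ') (m + m') ≤ ENNReal.ofReal (2 ^ (2 * s)) * (bwt ν s ℓ m + bwt ν s ℓ' m') := by
  set a := max 1 (max ‖ℓ‖ ((|m| : ℤ) : ℝ))
  set b := max 1 (max ‖ℓ'‖ ((|m'| : ℤ) : ℝ))
  have ha0 : 0 < a := bwt_base_pos ℓ m
  have hb0 : 0 < b := bwt_base_pos ℓ' m'
  have hℓ : ‖ℓ‖ ≤ a := (le_max_left _ _).trans (le_max_right _ _)
  have hℓ' : ‖ℓ'‖ ≤ b := (le_max_left _ _).trans (le_max_right _ _)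
  have hm : ((|m| : ℤ) : ℝ) ≤ a := (le_max_right _ _).trans (le_max_right _ _)
  have hm' : ((|m'| : ℤ) : ℝ) ≤ b := (le_max_right _ _).trans (le_max_right _ _)
  have hab : max 1 (max ‖ℓ + ℓ'‖ ((|m + m'| : ℤ) : ℝ)) ≤ 2 * max a b := by
    have hmax : a + b ≤ 2 * max a b := by linarith [le_max_left a b, le_max_right a b]
    have h1 : 1 ≤ a := le_max_left _ _
    have hmm : ((|m + m'| : ℤ) : ℝ) ≤ ((|m| : ℤ) : ℝ) + ((|m'| : ℤ) : ℝ) := by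
      exact_mod_cast abs_add_le m m'
    refine le_trans (max_le (by linarith) (max_le ?_ (by linarith))) hmax
    linarith [norm_add_le ℓ ℓ']
  rw [bwt, bwt, bwt, ← ENNReal.ofReal_add (by positivity) (by positivity),
    ← ENNReal.ofReal_mul (by positivity)]
  refine ENNReal.ofReal_le_ofReal ?_
  calc (max 1 (max ‖ℓ + ℓ'‖ ((|m + m'| : ℤ) : ℝ))) ^ (2 * s) ≤ (2 * max a b) ^ (2 * s) :=
        Real.rpow_le_rpow (bwt_base_pos _ _).le hab (by positivity)
    _ = 2 ^ (2 * s) * (max a b) ^ (2 * s) := Real.mul_rpow (by norm_num) (by positivity)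
    _ ≤ 2 ^ (2 * s) * (a ^ (2 * s) + b ^ (2 * s)) := by
        gcongr
        rcases max_choice a b with h | h <;> rw [h]
        · linarith [Real.rpow_nonneg hb0.le (2 * s)]
        · linarith [Real.rpow_nonneg ha0.le (2 * s)]

/-- The inverse weight is summable over `ℤ^ν × ℤ` as soon as `2s > ν + 1`. -/
lemma tsum_bwt_inv_ne_top {s : ℝ} (hs : (ν : ℝ) + 1 < 2 * s) :
    ∑' x : (Fin ν → ℤ) × ℤ, (bwt ν s x.1 x.2)⁻¹ ≠ ⊤ := by
  set t : ℝ := 2 * s / (ν + 1) with ht_def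
  have hν : (0 : ℝ) < ν + 1 := by positivity
  have ht : 1 < t := by rwa [ht_def, one_lt_div hν]
  let a : ℤ → ℝ≥0∞ := fun n ↦ ENNReal.ofReal ((max 1 ((|n| : ℤ) : ℝ)) ^ (-t))
  have ha : ∑' n, a n ≠ ⊤ := tsum_ofReal_max_one_abs_rpow_ne_top ht
  have hfin : ∑' x : (Fin ν → ℤ) × ℤ, (∏ i, a (x.1 i)) * a x.2 ≠ ⊤ := by
    rw [ENNReal.tsum_prod']
    simp only [ENNReal.tsum_mul_left, ENNReal.tsum_mul_right]
    exact ENNReal.mul_ne_top (ENNReal.tsum_prod_pi_ne_top ha ν) ha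
  refine ne_top_of_le_ne_top hfin (ENNReal.tsum_le_tsum fun ⟨ℓ, m⟩ ↦ ?_)
  set M := max 1 (max ‖ℓ‖ ((|m| : ℤ) : ℝ))
  have hM0 : 0 < M := bwt_base_pos ℓ m
  have hle {n : ℤ} (hn : ((|n| : ℤ) : ℝ) ≤ max ‖ℓ‖ ((|m| : ℤ) : ℝ)) :
      ENNReal.ofReal (M ^ (-t)) ≤ a n :=
    ENNReal.ofReal_le_ofReal <| Real.rpow_le_rpow_of_nonpos (lt_max_of_lt_left one_pos)
      (max_le_max le_rfl hn) (by linarith)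
  calc (bwt ν s ℓ m)⁻¹ = (∏ _i : Fin ν, ENNReal.ofReal (M ^ (-t))) * ENNReal.ofReal (M ^ (-t)) := by
        rw [Finset.prod_const, Finset.card_univ, Fintype.card_fin, ← pow_succ, bwt,
          ← ENNReal.ofReal_inv_of_pos (Real.rpow_pos_of_pos hM0 _),
          ← ENNReal.ofReal_pow (Real.rpow_nonneg hM0.le _), ← Real.rpow_natCast,
          ← Real.rpow_mul hM0.le, ← Real.rpow_neg hM0.le]
        congr 2
        rw [ht_def]
        push_cast
        field_simp
    _ ≤ (∏ i, a (ℓ i)) * a m := by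
        refine mul_le_mul' (Finset.prod_le_prod' fun i _ ↦ hle ?_) (hle (le_max_right _ _))
        refine le_trans ?_ (le_max_left _ _)
        simpa [Int.norm_eq_abs] using norm_le_pi_norm ℓ i

end Weight

lemma enorm_mulVec_le (M : Matrix (Fin 2) (Fin 2) ℂ) (v : Fin 2 → ℂ) :
    ‖M.mulVec v‖ₑ ≤ 2 * (frobSq M ^ (1 / 2 : ℝ) * vecSq v ^ (1 / 2 : ℝ)) := by
  have hM (i j : Fin 2) : ‖M i j‖ₑ ≤ frobSq M ^ (1 / 2 : ℝ) :=
    ENNReal.le_rpow_half_of_sq_le <|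
      (Finset.single_le_sum (f := fun j ↦ ‖M i j‖ₑ ^ 2) (fun _ _ ↦ zero_le)
        (Finset.mem_univ j)).trans
      (Finset.single_le_sum (f := fun i ↦ ∑ j, ‖M i j‖ₑ ^ 2) (fun _ _ ↦ zero_le)
        (Finset.mem_univ i))
  have hv (j : Fin 2) : ‖v j‖ₑ ≤ vecSq v ^ (1 / 2 : ℝ) :=
    ENNReal.le_rpow_half_of_sq_le <|
      Finset.single_le_sum (f := fun j ↦ ‖v j‖ₑ ^ 2) (fun _ _ ↦ zero_le) (Finset.mem_univ j)
  rw [← edist_zero_right, edist_pi_le_iff]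
  intro i
  rw [Pi.zero_apply, edist_zero_right]
  calc ‖M.mulVec v i‖ₑ = ‖M i 0 * v 0 + M i 1 * v 1‖ₑ := by
        simp [Matrix.mulVec, dotProduct, Fin.sum_univ_two]
    _ ≤ ‖M i 0‖ₑ * ‖v 0‖ₑ + ‖M i 1‖ₑ * ‖v 1‖ₑ := by
        simpa only [enorm_mul] using enorm_add_le (M i 0 * v 0) (M i 1 * v 1)
    _ ≤ _ := by
        rw [two_mul]
        exact add_le_add (mul_le_mul' (hM i 0) (hv 0)) (mul_le_mul' (hM i 1) (hv 1))

lemma vecSq_le_enorm_sq (v : Fin 2 → ℂ) : vecSq v ≤ 2 * ‖v‖ₑ ^ 2 := by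
  have hv (i : Fin 2) : ‖v i‖ₑ ≤ ‖v‖ₑ := ENNReal.coe_le_coe.2 (nnnorm_le_pi_nnnorm v i)
  rw [vecSq, Fin.sum_univ_two, two_mul]
  exact add_le_add (pow_le_pow_left' (hv 0) 2) (pow_le_pow_left' (hv 1) 2)

section Action

variable {ν : ℕ}

lemma vecSq_bact_le (R : BlockOp ν) (h : (Fin ν → ℤ) → ℕ+ → Fin 2 → ℂ) (ℓ : Fin ν → ℤ) (j : ℕ+) :
    vecSq (bact R h ℓ j) ≤ 8 * (∑' q : (Fin ν → ℤ) × ℕ+,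
      frobSq (R (ℓ - q.1) j q.2) ^ (1 / 2 : ℝ) * vecSq (h q.1 q.2) ^ (1 / 2 : ℝ)) ^ 2 := by
  refine (vecSq_le_enorm_sq _).trans ?_
  have hle : ‖bact R h ℓ j‖ₑ ≤ 2 * ∑' q : (Fin ν → ℤ) × ℕ+,
      frobSq (R (ℓ - q.1) j q.2) ^ (1 / 2 : ℝ) * vecSq (h q.1 q.2) ^ (1 / 2 : ℝ) := by
    rw [← ENNReal.tsum_mul_left]
    exact enorm_tsum_le_tsum_enorm.trans (ENNReal.tsum_le_tsum fun q ↦ enorm_mulVec_le _ _)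
  calc 2 * ‖bact R h ℓ j‖ₑ ^ 2 ≤ 2 * (2 * _) ^ 2 := mul_le_mul' le_rfl (pow_le_pow_left' hle 2)
    _ = _ := by ring

lemma seqNorm_sq (s : ℝ) (h : (Fin ν → ℤ) → ℕ+ → Fin 2 → ℂ) :
    seqNorm s h ^ 2 = ∑' q : (Fin ν → ℤ) × ℕ+, bwt ν s q.1 ((q.2 : ℕ) : ℤ) * vecSq (h q.1 q.2) := by
  rw [seqNorm, ENNReal.rpow_half_sq, ENNReal.tsum_prod']

lemma tsum_bwt_mul_frobSq_le (s : ℝ) (R : BlockOp ν) (q : (Fin ν → ℤ) × ℕ+) :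
    ∑' p : (Fin ν → ℤ) × ℕ+, bwt ν s (p.1 - q.1) (((p.2 : ℕ) : ℤ) - ((q.2 : ℕ) : ℤ)) *
      frobSq (R (p.1 - q.1) p.2 q.2) ≤ blockNorm s R ^ 2 := by
  rw [ENNReal.tsum_prod']
  refine ((Equiv.subRight q.1).tsum_eq fun ℓ ↦ ∑' j : ℕ+,
    bwt ν s ℓ (((j : ℕ) : ℤ) - ((q.2 : ℕ) : ℤ)) * frobSq (R ℓ j q.2)).trans_le ?_
  refine (ENNReal.rpow_half_sq _).symm.trans_le (pow_le_pow_left' ?_ 2)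
  exact le_iSup (fun j' : ℕ+ ↦ (∑' ℓ : Fin ν → ℤ, ∑' j : ℕ+,
    bwt ν s ℓ (((j : ℕ) : ℤ) - ((j' : ℕ) : ℤ)) * frobSq (R ℓ j j')) ^ (1 / 2 : ℝ)) q.2

/-- The squared form of the tame estimate, with an explicit constant. -/
lemma seqNorm_bact_sq_le {s : ℝ} (hs : 0 ≤ s) (σ : ℝ) (R : BlockOp ν)
    (h : (Fin ν → ℤ) → ℕ+ → Fin 2 → ℂ) :
    seqNorm s (bact R h) ^ 2 ≤
      16 * ENNReal.ofReal (2 ^ s) ^ 2 * (∑' x : (Fin ν → ℤ) × ℤ, (bwt ν σ x.1 x.2)⁻¹) *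
        (blockNorm s R * seqNorm σ h + blockNorm σ R * seqNorm s h) ^ 2 := by
  set K := ∑' x : (Fin ν → ℤ) × ℤ, (bwt ν σ x.1 x.2)⁻¹
  set c := ENNReal.ofReal (2 ^ s)
  let P := (Fin ν → ℤ) × ℕ+
  let w (t : ℝ) (q : P) : ℝ≥0∞ := bwt ν t q.1 ((q.2 : ℕ) : ℤ)
  let d (t : ℝ) (p q : P) : ℝ≥0∞ := bwt ν t (p.1 - q.1) (((p.2 : ℕ) : ℤ) - ((q.2 : ℕ) : ℤ))
  let r (p q : P) : ℝ≥0∞ := frobSq (R (p.1 - q.1) p.2 q.2) ^ (1 / 2 : ℝ)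
  let v (q : P) : ℝ≥0∞ := vecSq (h q.1 q.2) ^ (1 / 2 : ℝ)
  have hw (t : ℝ) (q : P) : w (t / 2) q ^ 2 = w t q := bwt_half_sq _ _ _
  have hd (t : ℝ) (p q : P) : d (t / 2) p q ^ 2 = d t p q := bwt_half_sq _ _ _
  have hr (p q : P) : r p q ^ 2 = frobSq (R (p.1 - q.1) p.2 q.2) := ENNReal.rpow_half_sq _
  have hv (t : ℝ) : ∑' q, w t q * v q ^ 2 = seqNorm t h ^ 2 := by
    simp only [v, ENNReal.rpow_half_sq, seqNorm_sq, w, P]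
  have hcol (t : ℝ) (q : P) : ∑' p, d t p q * r p q ^ 2 ≤ blockNorm t R ^ 2 := by
    simpa only [hr] using tsum_bwt_mul_frobSq_le t R q
  have hwK (_ : P) : ∑' q, (w σ q)⁻¹ ≤ K := by
    refine ENNReal.tsum_comp_le_tsum_of_injective
      (f := fun q : P ↦ (q.1, ((q.2 : ℕ) : ℤ))) ?_ fun x ↦ (bwt ν σ x.1 x.2)⁻¹
    rintro ⟨a, b⟩ ⟨a', b'⟩ hab
    simpa [P] using hab
  have hdK (p : P) : ∑' q, (d σ p q)⁻¹ ≤ K := by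
    refine ENNReal.tsum_comp_le_tsum_of_injective
      (f := fun q : P ↦ (p.1 - q.1, ((p.2 : ℕ) : ℤ) - ((q.2 : ℕ) : ℤ))) ?_
      fun x ↦ (bwt ν σ x.1 x.2)⁻¹
    rintro ⟨a, b⟩ ⟨a', b'⟩ hab
    simpa [P] using hab
  have hwcancel (q : P) : (w σ q)⁻¹ * w σ q = 1 :=
    ENNReal.inv_mul_cancel (bwt_ne_zero _ _ _) (bwt_ne_top _ _ _)
  have hdcancel (p q : P) : (d σ p q)⁻¹ * d σ p q = 1 :=
    ENNReal.inv_mul_cancel (bwt_ne_zero _ _ _) (bwt_ne_top _ _ _)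
  let A (p : P) : ℝ≥0∞ := ∑' q, d (s / 2) p q * r p q * v q
  let B (p : P) : ℝ≥0∞ := ∑' q, r p q * (w (s / 2) q * v q)
  have hA : ∑' p, A p ^ 2 ≤ K * (blockNorm s R ^ 2 * seqNorm σ h ^ 2) := by
    rw [← hv]
    refine ENNReal.tsum_sq_tsum_le (c := fun _ q ↦ (w σ q)⁻¹) (fun p q ↦ le_of_eq ?_) hwK (hcol s)
    calc (d (s / 2) p q * r p q * v q) ^ 2 = 1 * (d (s / 2) p q ^ 2 * r p q ^ 2 * v q ^ 2) := by ring
      _ = _ := by rw [← hwcancel q, hd]; ring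
  have hB : ∑' p, B p ^ 2 ≤ K * (blockNorm σ R ^ 2 * seqNorm s h ^ 2) := by
    rw [← hv]
    refine ENNReal.tsum_sq_tsum_le (fun p q ↦ le_of_eq ?_) hdK (hcol σ)
    calc (r p q * (w (s / 2) q * v q)) ^ 2 = 1 * (r p q ^ 2 * (w (s / 2) q ^ 2 * v q ^ 2)) := by ring
      _ = _ := by rw [← hdcancel p q, hw]; ring
  have hsplit (p q : P) : w (s / 2) p ≤ c * (d (s / 2) p q + w (s / 2) q) := by
    have := bwt_add_le (s := s / 2) (by positivity) (p.1 - q.1) q.1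
      (((p.2 : ℕ) : ℤ) - ((q.2 : ℕ) : ℤ)) ((q.2 : ℕ) : ℤ)
    rwa [sub_add_cancel, sub_add_cancel, mul_div_cancel₀ s two_ne_zero] at this
  have hpoint (p : P) : w s p * vecSq (bact R h p.1 p.2) ≤ 16 * c ^ 2 * (A p ^ 2 + B p ^ 2) := by
    have hsum : w (s / 2) p * ∑' q, r p q * v q ≤ c * (A p + B p) := by
      rw [← ENNReal.tsum_mul_left, ← ENNReal.tsum_add, ← ENNReal.tsum_mul_left]
      refine ENNReal.tsum_le_tsum fun q ↦ (mul_le_mul' (hsplit p q) le_rfl).trans_eq ?_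
      ring
    calc w s p * vecSq (bact R h p.1 p.2) ≤ w s p * (8 * (∑' q, r p q * v q) ^ 2) :=
          mul_le_mul' le_rfl (vecSq_bact_le R h p.1 p.2)
      _ = 8 * (w (s / 2) p * ∑' q, r p q * v q) ^ 2 := by rw [← hw]; ring
      _ ≤ 8 * (c * (A p + B p)) ^ 2 := mul_le_mul' le_rfl (pow_le_pow_left' hsum 2)
      _ = 8 * c ^ 2 * (A p + B p) ^ 2 := by ring
      _ ≤ 8 * c ^ 2 * (2 * (A p ^ 2 + B p ^ 2)) := mul_le_mul' le_rfl (ENNReal.add_sq_le_two_mul _ _)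
      _ = _ := by ring
  calc seqNorm s (bact R h) ^ 2 ≤ ∑' p, 16 * c ^ 2 * (A p ^ 2 + B p ^ 2) := by
        rw [seqNorm_sq]
        exact ENNReal.tsum_le_tsum hpoint
    _ = 16 * c ^ 2 * (∑' p, A p ^ 2 + ∑' p, B p ^ 2) := by
        rw [ENNReal.tsum_mul_left, ENNReal.tsum_add]
    _ ≤ 16 * c ^ 2 * (K * (blockNorm s R ^ 2 * seqNorm σ h ^ 2) +
          K * (blockNorm σ R ^ 2 * seqNorm s h ^ 2)) :=
        mul_le_mul' le_rfl (add_le_add hA hB)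
    _ = 16 * c ^ 2 * K * ((blockNorm s R * seqNorm σ h) ^ 2 +
          (blockNorm σ R * seqNorm s h) ^ 2) := by ring
    _ ≤ _ := by
        refine mul_le_mul' le_rfl ?_
        rw [add_sq, add_right_comm]
        exact le_self_add

end Action

/-- Tame estimate for the action of an operator with finite block-decay norm
(Lemma 2.8): `‖R·h‖_s ≤ C(s, ν) (|R|_s ‖h‖_{s₀} + |R|_{s₀} ‖h‖_s)`. -/
theorem seqNorm_bact (ν : ℕ) (hν : 1 ≤ ν) (s : ℝ) (hs : ((s0 ν : ℕ) : ℝ) ≤ s) :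
    ∃ C : ℝ≥0∞, 0 < C ∧ C < ⊤ ∧
      ∀ (R : BlockOp ν) (h : (Fin ν → ℤ) → ℕ+ → Fin 2 → ℂ),
        blockNorm s R < ⊤ → seqNorm s h < ⊤ →
        seqNorm s (bact R h) ≤
          C * (blockNorm s R * seqNorm ((s0 ν : ℕ) : ℝ) h +
               blockNorm ((s0 ν : ℕ) : ℝ) R * seqNorm s h) := by
  have hσ : (ν : ℝ) + 1 < 2 * ((s0 ν : ℕ) : ℝ) := by
    have : ν + 1 < 2 * s0 ν := by unfold s0; omega
    exact_mod_cast this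
  have hs0 : 0 ≤ s := (Nat.cast_nonneg _).trans hs
  set D := 16 * ENNReal.ofReal (2 ^ s) ^ 2 *
    ∑' x : (Fin ν → ℤ) × ℤ, (bwt ν ((s0 ν : ℕ) : ℝ) x.1 x.2)⁻¹
  have hD : D ≠ ⊤ := ENNReal.mul_ne_top
    (ENNReal.mul_ne_top (by norm_num) (ENNReal.pow_ne_top ENNReal.ofReal_ne_top))
    (tsum_bwt_inv_ne_top hσ)
  refine ⟨D ^ (1 / 2 : ℝ) + 1, by simp, ?_, fun R h _ _ ↦ ?_⟩
  · exact ENNReal.add_lt_top.2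
      ⟨ENNReal.rpow_lt_top_of_nonneg (by norm_num) hD, ENNReal.one_lt_top⟩
  · rw [← ENNReal.pow_le_pow_left_iff two_ne_zero]
    refine (seqNorm_bact_sq_le hs0 ((s0 ν : ℕ) : ℝ) R h).trans ?_
    rw [mul_pow]
    refine mul_le_mul' ?_ le_rfl
    calc D = (D ^ (1 / 2 : ℝ)) ^ 2 := (ENNReal.rpow_half_sq D).symm
      _ ≤ _ := pow_le_pow_left' le_self_add 2
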